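/- If U and V are random vectors in ℝ^D with d_3(U,V) ≤ 2√D, then d_1(U,V) ≤ 2 (2√D)^{2/3} (d_3(U,V))^{1/3}. -/

import Mathlib

open MeasureTheory ProbabilityTheory Finset

noncomputable section

/-- `ζ` is `1`-Lipschitz with respect to the Euclidean norm on `ι → ℝ`. -/
def LipschitzEuclid {ι : Type*} [Fintype ι] (ζ : (ι → ℝ) → ℝ) : Prop :=
  ∀ f g : ι → ℝ, |ζ f - ζ g| ≤ Real.sqrt (∑ i, (f i - g i) ^ 2)

/-- The Wasserstein-1 distance between the laws of `X` and `Y`, as a supremum over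
`1`-Lipschitz (w.r.t. the Euclidean norm) test functions. -/
def d1 {Ω : Type*} [MeasurableSpace Ω] {ι : Type*} [Fintype ι]
    (μ : Measure Ω) (X Y : Ω → ι → ℝ) : ℝ :=
  sSup {r | ∃ ζ : (ι → ℝ) → ℝ, LipschitzEuclid ζ ∧
    r = |(∫ ω, ζ (X ω) ∂μ) - ∫ ω, ζ (Y ω) ∂μ|}

/-- First partial derivative of `η` at `x` in coordinate `i`. -/
def pd1 {ι : Type*} [Fintype ι] [DecidableEq ι] (η : (ι → ℝ) → ℝ) (x : ι → ℝ) (i : ι) : ℝ :=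
  iteratedFDeriv ℝ 1 η x fun _ => Pi.single i 1

/-- Second partial derivative of `η` at `x` in coordinates `i, j`. -/
def pd2 {ι : Type*} [Fintype ι] [DecidableEq ι] (η : (ι → ℝ) → ℝ) (x : ι → ℝ) (i j : ι) : ℝ :=
  iteratedFDeriv ℝ 2 η x ![Pi.single i 1, Pi.single j 1]

/-- Third partial derivative of `η` at `x` in coordinates `i, j, k`. -/
def pd3 {ι : Type*} [Fintype ι] [DecidableEq ι] (η : (ι → ℝ) → ℝ) (x : ι → ℝ) (i j k : ι) : ℝ :=
  iteratedFDeriv ℝ 3 η x ![Pi.single i 1, Pi.single j 1, Pi.single k 1]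

/-- Test functions for the `d₃` metric: three times differentiable with all first, second and
third partial derivatives bounded by one. -/
def TestD3 {ι : Type*} [Fintype ι] [DecidableEq ι] (ζ : (ι → ℝ) → ℝ) : Prop :=
  ContDiff ℝ 3 ζ ∧ (∀ x i, |pd1 ζ x i| ≤ 1) ∧ (∀ x i j, |pd2 ζ x i j| ≤ 1) ∧
    (∀ x i j k, |pd3 ζ x i j k| ≤ 1)

/-- The `d₃` integral probability metric between the laws of `X` and `Y`. -/
def d3 {Ω : Type*} [MeasurableSpace Ω] {ι : Type*} [Fintype ι] [DecidableEq ι]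
    (μ : Measure Ω) (X Y : Ω → ι → ℝ) : ℝ :=
  sSup {r | ∃ ζ : (ι → ℝ) → ℝ, TestD3 ζ ∧
    r = |(∫ ω, ζ (X ω) ∂μ) - ∫ ω, ζ (Y ω) ∂μ|}


/-- The uniform distribution on the interval `[-h, h]`. -/
def symmUniform (h : ℝ) : Measure ℝ :=
  ENNReal.ofReal (2 * h)⁻¹ • volume.restrict (Set.Icc (-h) h)

lemma isProbabilityMeasure_symmUniform {h : ℝ} (hh : 0 < h) :
    IsProbabilityMeasure (symmUniform h) := by
  constructor
  simp only [symmUniform, Measure.smul_apply, Measure.restrict_apply_univ, Real.volume_Icc,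
    smul_eq_mul]
  rw [← ENNReal.ofReal_mul (by positivity), ← ENNReal.ofReal_one]
  congr 1
  field_simp
  ring

instance isFiniteMeasure_symmUniform (h : ℝ) : IsFiniteMeasure (symmUniform h) := by
  unfold symmUniform
  exact Measure.smul_finite _ ENNReal.ofReal_ne_top

lemma restrict_symmUniform (h : ℝ) :
    (symmUniform h).restrict (Set.Icc (-h) h) = symmUniform h := by
  simp [symmUniform, Measure.restrict_smul, Measure.restrict_restrict]

lemma integral_symmUniform {h : ℝ} (hh : 0 < h) (f : ℝ → ℝ) :
    ∫ u, f u ∂symmUniform h = (2 * h)⁻¹ * ∫ u in (-h)..h, f u := by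
  rw [symmUniform, integral_smul_measure, intervalIntegral.integral_of_le (by linarith),
    integral_Icc_eq_integral_Ioc, ENNReal.toReal_ofReal (by positivity), smul_eq_mul]

lemma integral_symmUniform_add_sq {h : ℝ} (hh : 0 < h) (a : ℝ) :
    ∫ u, (a + u) ^ 2 ∂symmUniform h = a ^ 2 + h ^ 2 / 3 := by
  rw [integral_symmUniform hh, intervalIntegral.integral_comp_add_left (fun u => u ^ 2) a,
    integral_pow]
  field_simp
  ring

lemma abs_integral_symmUniform_shift_sub_le {h : ℝ} (hh : 0 < h) {g : ℝ → ℝ}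
    (hg : Continuous g) {M : ℝ} (hM : ∀ u, |g u| ≤ M) {b : ℝ} (hb : 0 ≤ b) :
    |∫ u, (g (u + b) - g u) ∂symmUniform h| ≤ M * b / h := by
  have hi : ∀ p q, IntervalIntegrable g volume p q := fun p q => hg.intervalIntegrable p q
  have hB : ∀ p, |∫ u in p..(p + b), g u| ≤ M * b := fun p => by
    have := intervalIntegral.norm_integral_le_of_norm_le_const (a := p) (b := p + b)
      (f := g) (C := M) (fun u _ => hM u)
    simpa [abs_of_nonneg hb] using this
  have key : ∫ u in (-h)..h, (g (u + b) - g u)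
      = (∫ u in h..(h + b), g u) - ∫ u in (-h)..(-h + b), g u := by
    have hs : IntervalIntegrable (fun u => g (u + b)) volume (-h) h :=
      (hg.comp (continuous_add_const b)).intervalIntegrable _ _
    rw [intervalIntegral.integral_sub hs (hi _ _),
      intervalIntegral.integral_comp_add_right,
      ← intervalIntegral.integral_add_adjacent_intervals (hi (-h) (-h + b)) (hi (-h + b) h),
      ← intervalIntegral.integral_add_adjacent_intervals (hi (-h + b) h) (hi h (h + b))]
    ring
  rw [integral_symmUniform hh, key, abs_mul, abs_of_pos (by positivity)]
  calc (2 * h)⁻¹ * |(∫ u in h..(h + b), g u) - ∫ u in (-h)..(-h + b), g u|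
      ≤ (2 * h)⁻¹ * (M * b + M * b) := by
        gcongr
        exact (abs_sub _ _).trans (add_le_add (hB _) (hB _))
    _ = M * b / h := by field_simp; ring

/-- The uniform distribution on the cube `[-h, h]^D`. -/
def cubeUniform (D : ℕ) (h : ℝ) : Measure (Fin D → ℝ) :=
  Measure.pi fun _ => symmUniform h

instance isFiniteMeasure_cubeUniform (D : ℕ) (h : ℝ) : IsFiniteMeasure (cubeUniform D h) := by
  unfold cubeUniform
  infer_instance

lemma isProbabilityMeasure_cubeUniform (D : ℕ) {h : ℝ} (hh : 0 < h) :
    IsProbabilityMeasure (cubeUniform D h) := by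
  have := isProbabilityMeasure_symmUniform hh
  unfold cubeUniform
  infer_instance

lemma restrict_cubeUniform (D : ℕ) (h : ℝ) :
    (cubeUniform D h).restrict (Set.univ.pi fun _ => Set.Icc (-h) h) = cubeUniform D h := by
  rw [cubeUniform, Measure.restrict_pi_pi]
  simp only [restrict_symmUniform]

lemma Continuous.integrable_cubeUniform {D : ℕ} {f : (Fin D → ℝ) → ℝ} (hf : Continuous f)
    (h : ℝ) : Integrable f (cubeUniform D h) := by
  rw [← restrict_cubeUniform]
  exact hf.continuousOn.integrableOn_compact (isCompact_univ_pi fun _ => isCompact_Icc)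

/-- The average of `f` over the cube of side `2 * h` centred at `x`. -/
def cubeAvg {D : ℕ} (h : ℝ) (f : (Fin D → ℝ) → ℝ) (x : Fin D → ℝ) : ℝ :=
  ∫ y, f (x + y) ∂cubeUniform D h

section cubeAvg

variable {D : ℕ} {h : ℝ} {f w : (Fin D → ℝ) → ℝ}

lemma Continuous.integrable_cubeUniform_add (hf : Continuous f) (h : ℝ) (x : Fin D → ℝ) :
    Integrable (fun y => f (x + y)) (cubeUniform D h) :=
  (hf.comp (continuous_const_add x)).integrable_cubeUniform h

lemma continuous_cubeAvg (hf : Continuous f) (h : ℝ) : Continuous (cubeAvg h f) := by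
  unfold cubeAvg
  rw [← restrict_cubeUniform]
  exact continuous_parametric_integral_of_continuous
    (f := fun x y : Fin D → ℝ => f (x + y)) (hf.comp continuous_add)
    (isCompact_univ_pi fun _ => isCompact_Icc)

lemma fwdDiff_cubeAvg (hf : Continuous f) (h : ℝ) (v : Fin D → ℝ) :
    fwdDiff v (cubeAvg h f) = cubeAvg h (fwdDiff v f) := by
  ext x
  simp only [fwdDiff, cubeAvg]
  rw [← integral_sub (hf.integrable_cubeUniform_add h _) (hf.integrable_cubeUniform_add h _)]
  simp only [add_right_comm x v]

lemma abs_cubeAvg_sub_le (hh : 0 < h) (hf : Continuous f) (hw : Continuous w) {a : ℝ}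
    (hfw : ∀ z, |f z - a| ≤ w z) (x : Fin D → ℝ) : |cubeAvg h f x - a| ≤ cubeAvg h w x := by
  have := isProbabilityMeasure_cubeUniform D hh
  have hfi := hf.integrable_cubeUniform_add h x
  have : cubeAvg h f x - a = ∫ y, (f (x + y) - a) ∂cubeUniform D h := by
    rw [integral_sub hfi (integrable_const a)]
    simp [cubeAvg]
  rw [this]
  exact (abs_integral_le_integral_abs).trans (integral_mono (hfi.sub (integrable_const a)).abs
    (hw.integrable_cubeUniform_add h x) fun y => hfw _)

lemma abs_cubeAvg_le (hh : 0 < h) {M : ℝ} (hM : ∀ z, |f z| ≤ M) (x : Fin D → ℝ) :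
    |cubeAvg h f x| ≤ M := by
  have := isProbabilityMeasure_cubeUniform D hh
  have := norm_integral_le_of_norm_le_const (μ := cubeUniform D h)
    (f := fun y => f (x + y)) (C := M) (.of_forall fun y => hM _)
  simpa [cubeAvg] using this

lemma cubeAvg_quadratic (hh : 0 < h) (A B : ℝ) (x : Fin D → ℝ) :
    cubeAvg h (fun z => A * ∑ i, (z i - x i) ^ 2 + B) =
      fun z => A * ∑ i, (z i - x i) ^ 2 + (A * (D * (h ^ 2 / 3)) + B) := by
  have := isProbabilityMeasure_cubeUniform D hh
  have := isProbabilityMeasure_symmUniform hh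
  ext z
  have hi : ∀ i : Fin D, Integrable (fun y : Fin D → ℝ => ((z + y) i - x i) ^ 2)
      (cubeUniform D h) := fun i =>
    Continuous.integrable_cubeUniform (by simp only [Pi.add_apply]; fun_prop) h
  have hv : ∀ i : Fin D, ∫ y, ((z + y) i - x i) ^ 2 ∂cubeUniform D h
      = (z i - x i) ^ 2 + h ^ 2 / 3 := fun i => by
    rw [← integral_symmUniform_add_sq hh]
    have := integral_comp_eval (μ := fun _ : Fin D => symmUniform h) (i := i)
      (f := fun u : ℝ => ((z i - x i) + u) ^ 2) (by fun_prop)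
    rw [← this, cubeUniform]
    congr with y
    simp only [Pi.add_apply]
    ring
  simp only [cubeAvg]
  rw [integral_add ((integrable_finsetSum _ fun i _ => hi i).const_mul A) (integrable_const B),
    integral_const_mul, integral_finsetSum _ fun i _ => hi i]
  simp only [hv, Finset.sum_add_distrib]
  simp
  ring

lemma abs_fwdDiff_cubeAvg_le (hh : 0 < h) (hf : Continuous f) {M : ℝ} (hM : ∀ z, |f z| ≤ M)
    (j : Fin D) {b : ℝ} (hb : 0 ≤ b) (x : Fin D → ℝ) :
    |fwdDiff (b • Pi.single j 1) (cubeAvg h f) x| ≤ M * b / h := by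
  cases D with
  | zero => exact j.elim0
  | succ n =>
    have := isProbabilityMeasure_symmUniform hh
    have := isProbabilityMeasure_cubeUniform n hh
    set G : (Fin (n + 1) → ℝ) → ℝ := fun y => f (x + b • Pi.single j 1 + y) - f (x + y) with hG
    have hGc : Continuous G := by fun_prop
    have hmp := (measurePreserving_piFinSuccAbove
      (fun _ : Fin (n + 1) => symmUniform h) j).symm
    have hGi : Integrable (fun p => G ((MeasurableEquiv.piFinSuccAbove
        (fun _ : Fin (n + 1) => ℝ) j).symm p)) ((symmUniform h).prod (cubeUniform n h)) :=
      (hmp.integrable_comp_emb (MeasurableEquiv.measurableEmbedding _)).2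
        (hGc.integrable_cubeUniform h)
    have hE : fwdDiff (b • Pi.single j 1) (cubeAvg h f) x
        = ∫ q, ∫ u, G (Fin.insertNth j u q) ∂symmUniform h ∂cubeUniform n h := by
      simp only [fwdDiff, cubeAvg]
      rw [← integral_sub (hf.integrable_cubeUniform_add h _)
        (hf.integrable_cubeUniform_add h _)]
      exact (hmp.integral_comp' G).symm.trans (integral_prod_symm _ hGi)
    rw [hE]
    have hb' : ∀ q : Fin n → ℝ,
        ‖∫ u, G (Fin.insertNth j u q) ∂symmUniform h‖ ≤ M * b / h := fun q => by
      have hc : Continuous fun u : ℝ => f (x + Fin.insertNth (α := fun _ => ℝ) j u q) := by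
        fun_prop
      have := abs_integral_symmUniform_shift_sub_le hh hc (fun u => hM _) hb
      convert this using 5
      simp only [hG]
      congr 3 with u
      congr 2
      rw [add_assoc]
      congr 1
      ext i
      refine Fin.succAboveCases j ?_ (fun i => ?_) i <;> simp [add_comm]
    simpa using norm_integral_le_of_norm_le_const (μ := cubeUniform n h)
      (.of_forall hb')

end cubeAvg

/-- The convolution of `f` with the normalised bump function `φ`. -/
def mollify {D : ℕ} (φ : ContDiffBump (0 : Fin D → ℝ)) (f : (Fin D → ℝ) → ℝ) :
    (Fin D → ℝ) → ℝ :=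
  convolution (φ.normed volume) f (ContinuousLinearMap.lsmul ℝ ℝ) volume

section mollify

variable {D : ℕ} {f : (Fin D → ℝ) → ℝ} (φ : ContDiffBump (0 : Fin D → ℝ))

lemma contDiff_mollify (hf : Continuous f) : ContDiff ℝ 3 (mollify φ f) :=
  (φ.hasCompactSupport_normed (μ := volume)).contDiff_convolution_left (n := 3) _
    φ.contDiff_normed hf.locallyIntegrable

lemma fwdDiff_mollify (hf : Continuous f) (v : Fin D → ℝ) :
    fwdDiff v (mollify φ f) = mollify φ (fwdDiff v f) := by
  have hi := (φ.hasCompactSupport_normed (μ := volume)).convolutionExists_left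
    (ContinuousLinearMap.lsmul ℝ ℝ) φ.continuous_normed (hf.locallyIntegrable (μ := volume))
  ext x
  simp only [fwdDiff, mollify, convolution_def]
  rw [← integral_sub (hi _) (hi _)]
  congr with y
  rw [← map_sub, sub_add_eq_add_sub]

lemma abs_mollify_le (hf : Continuous f) {M : ℝ} (hM : ∀ z, |f z| ≤ M) (x : Fin D → ℝ) :
    |mollify φ f x| ≤ M := by
  have := dist_convolution_le (μ := volume) (f := φ.normed volume) (g := f) (z₀ := 0)
    (x₀ := x) (R := φ.rOut) ((abs_nonneg _).trans (hM 0)) φ.support_normed_eq.subset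
    φ.nonneg_normed φ.integral_normed hf.aestronglyMeasurable (fun z _ => by simpa using hM z)
  simpa [mollify] using this

end mollify

section fwdDiff

variable {E : Type*} [NormedAddCommGroup E] [NormedSpace ℝ E] {f : E → ℝ} {C : ℝ}

lemma abs_fderiv_le_of_abs_fwdDiff_le {x v : E} (hf : DifferentiableAt ℝ f x)
    (hC : ∀ a : ℝ, 0 < a → |fwdDiff (a • v) f x| ≤ C * a) : |fderiv ℝ f x v| ≤ C := by
  refine le_of_tendsto (hf.hasFDerivAt.hasLineDerivAt v).tendsto_slope_zero_right.abs ?_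
  filter_upwards [self_mem_nhdsWithin] with a (ha : 0 < a)
  rw [smul_eq_mul, abs_mul, abs_of_pos (inv_pos.2 ha), inv_mul_le_iff₀ ha, mul_comm]
  exact hC a ha

lemma fwdDiff_fderiv_apply (hf : Differentiable ℝ f) (w v : E) :
    fwdDiff w (fun y => fderiv ℝ f y v) = fun y => fderiv ℝ (fwdDiff w f) y v := by
  ext y
  have h1 : DifferentiableAt ℝ (fun z => f (z + w)) y := by fun_prop
  unfold fwdDiff
  rw [fderiv_fun_sub h1 (hf y), fderiv_comp_add_right]
  rfl

lemma ContDiff.fwdDiff {n : WithTop ℕ∞} (hf : ContDiff ℝ n f) (w : E) :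
    ContDiff ℝ n (fwdDiff w f) := by
  unfold _root_.fwdDiff
  fun_prop

lemma abs_fderiv_fderiv_le_of_abs_fwdDiff_le {u v : E} (hf : ContDiff ℝ 2 f)
    (hC : ∀ a b : ℝ, 0 < a → 0 < b → ∀ x,
      |fwdDiff (b • v) (fwdDiff (a • u) f) x| ≤ C * a * b) (x : E) :
    |fderiv ℝ (fun y => fderiv ℝ f y v) x u| ≤ C := by
  have hd := (hf.fderiv_right (m := 1) le_rfl).clm_apply (contDiff_const (c := v))
  refine abs_fderiv_le_of_abs_fwdDiff_le (hd.differentiable one_ne_zero x) fun a ha => ?_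
  rw [fwdDiff_fderiv_apply (hf.differentiable two_ne_zero)]
  exact abs_fderiv_le_of_abs_fwdDiff_le ((hf.fwdDiff _).differentiable two_ne_zero x)
    fun b hb => hC a b ha hb x

lemma abs_fderiv_fderiv_fderiv_le_of_abs_fwdDiff_le {u v w : E} (hf : ContDiff ℝ 3 f)
    (hC : ∀ a b c : ℝ, 0 < a → 0 < b → 0 < c → ∀ x,
      |fwdDiff (c • w) (fwdDiff (b • v) (fwdDiff (a • u) f)) x| ≤ C * a * b * c) (x : E) :
    |fderiv ℝ (fun y => fderiv ℝ (fun z => fderiv ℝ f z w) y v) x u| ≤ C := by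
  have hd := (hf.fderiv_right (m := 2) le_rfl).clm_apply (contDiff_const (c := w))
  have hdd := (hd.fderiv_right (m := 1) le_rfl).clm_apply (contDiff_const (c := v))
  refine abs_fderiv_le_of_abs_fwdDiff_le (hdd.differentiable one_ne_zero x) fun a ha => ?_
  rw [fwdDiff_fderiv_apply (hd.differentiable two_ne_zero),
    fwdDiff_fderiv_apply (hf.differentiable three_ne_zero)]
  exact abs_fderiv_fderiv_le_of_abs_fwdDiff_le ((hf.fwdDiff _).of_le (by norm_num))
    (fun b c hb hc => hC a b c ha hb hc) x

end fwdDiff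

section partialDerivatives

variable {ι : Type*} [Fintype ι] [DecidableEq ι] {η : (ι → ℝ) → ℝ}

lemma pd1_eq_fderiv (x : ι → ℝ) (i : ι) : pd1 η x i = fderiv ℝ η x (Pi.single i 1) := by
  simp [pd1, iteratedFDeriv_one_apply]

lemma pd2_eq_fderiv (hη : ContDiff ℝ 2 η) (x : ι → ℝ) (i j : ι) :
    pd2 η x i j = fderiv ℝ (fun y => fderiv ℝ η y (Pi.single j 1)) x (Pi.single i 1) := by
  have := (hη.fderiv_right (m := 1) le_rfl).differentiable one_ne_zero x
  rw [pd2, iteratedFDeriv_two_apply, fderiv_clm_apply this (differentiableAt_const _)]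
  simp

lemma pd3_eq_fderiv (hη : ContDiff ℝ 3 η) (x : ι → ℝ) (i j k : ι) :
    pd3 η x i j k = fderiv ℝ (fun y => fderiv ℝ (fun z => fderiv ℝ η z (Pi.single k 1)) y
      (Pi.single j 1)) x (Pi.single i 1) := by
  have h2 : (fun y => fderiv ℝ (fun z => fderiv ℝ η z (Pi.single k 1)) y (Pi.single j 1))
      = fun y => iteratedFDeriv ℝ 2 η y ![Pi.single j 1, Pi.single k 1] := by
    ext y
    exact (pd2_eq_fderiv (hη.of_le (by norm_num)) y j k).symm
  have hd := hη.differentiable_iteratedFDeriv (m := 2) (by norm_num) x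
  rw [h2, pd3, iteratedFDeriv_succ_apply_left,
    (hd.hasFDerivAt.continuousMultilinear_apply_const _).fderiv]
  rfl

lemma TestD3.of_abs_fwdDiff_le (hη : ContDiff ℝ 3 η)
    (h1 : ∀ i, ∀ a : ℝ, 0 < a → ∀ x, |fwdDiff (a • Pi.single i 1) η x| ≤ a)
    (h2 : ∀ i j, ∀ a b : ℝ, 0 < a → 0 < b → ∀ x,
      |fwdDiff (b • Pi.single j 1) (fwdDiff (a • Pi.single i 1) η) x| ≤ a * b)
    (h3 : ∀ i j k, ∀ a b c : ℝ, 0 < a → 0 < b → 0 < c → ∀ x,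
      |fwdDiff (c • Pi.single k 1) (fwdDiff (b • Pi.single j 1)
        (fwdDiff (a • Pi.single i 1) η)) x| ≤ a * b * c) : TestD3 η := by
  refine ⟨hη, fun x i => ?_, fun x i j => ?_, fun x i j k => ?_⟩
  · rw [pd1_eq_fderiv]
    exact abs_fderiv_le_of_abs_fwdDiff_le (hη.differentiable three_ne_zero x)
      fun a ha => by simpa using h1 i a ha x
  · have hη2 : ContDiff ℝ 2 η := hη.of_le (by norm_num)
    rw [pd2_eq_fderiv hη2]
    exact abs_fderiv_fderiv_le_of_abs_fwdDiff_le hη2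
      (fun a b ha hb x => by simpa using h2 i j a b ha hb x) x
  · rw [pd3_eq_fderiv hη]
    exact abs_fderiv_fderiv_fderiv_le_of_abs_fwdDiff_le hη
      (fun a b c ha hb hc x => by simpa using h3 i j k a b c ha hb hc x) x

end partialDerivatives

section LipschitzEuclid

lemma LipschitzEuclid.add_const {ι : Type*} [Fintype ι] {ζ : (ι → ℝ) → ℝ}
    (hζ : LipschitzEuclid ζ) (c : ℝ) : LipschitzEuclid fun x => ζ x + c :=
  fun f g => by simpa using hζ f g

lemma sqrt_sum_sq_le_sqrt_card_mul_norm {D : ℕ} (v : Fin D → ℝ) :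
    √(∑ i, v i ^ 2) ≤ √D * ‖v‖ := by
  rw [← Real.sqrt_sq (norm_nonneg v), ← Real.sqrt_mul (Nat.cast_nonneg D)]
  refine Real.sqrt_le_sqrt ?_
  calc ∑ i, v i ^ 2 ≤ ∑ _i : Fin D, ‖v‖ ^ 2 :=
        Finset.sum_le_sum fun i _ => sq_le_sq.2 (by simpa using norm_le_pi_norm v i)
    _ = D * ‖v‖ ^ 2 := by simp

lemma sqrt_le_mul_add_div_two {s c : ℝ} (hs : 0 ≤ s) (hc : 0 < c) :
    √s ≤ (2 * c)⁻¹ * s + c / 2 := by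
  have h := sq_nonneg (√s - c)
  rw [sub_sq, Real.sq_sqrt hs] at h
  have : (2 * c)⁻¹ * s + c / 2 = (s + c ^ 2) / (2 * c) := by field_simp
  rw [this, le_div_iff₀ (by positivity)]
  linarith

variable {D : ℕ} {ζ : (Fin D → ℝ) → ℝ}

lemma LipschitzEuclid.continuous (hζ : LipschitzEuclid ζ) : Continuous ζ := by
  refine (LipschitzWith.of_dist_le_mul (K := NNReal.sqrt D) fun x y => ?_).continuous
  rw [Real.dist_eq, dist_eq_norm]
  simpa using (hζ x y).trans (sqrt_sum_sq_le_sqrt_card_mul_norm (x - y))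

lemma LipschitzEuclid.abs_fwdDiff_le (hζ : LipschitzEuclid ζ) (v x : Fin D → ℝ) :
    |fwdDiff v ζ x| ≤ √(∑ i, v i ^ 2) := by
  simpa [fwdDiff] using hζ (x + v) x

lemma LipschitzEuclid.abs_fwdDiff_single_le (hζ : LipschitzEuclid ζ) (i : Fin D) {a : ℝ}
    (ha : 0 ≤ a) (x : Fin D → ℝ) : |fwdDiff (a • Pi.single i 1) ζ x| ≤ a := by
  refine (hζ.abs_fwdDiff_le _ x).trans_eq ?_
  rw [Finset.sum_eq_single i (fun j _ hj => by simp [hj]) (by simp)]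
  simp [Real.sqrt_sq ha]

lemma LipschitzEuclid.cubeAvg {h : ℝ} (hh : 0 < h) (hζ : LipschitzEuclid ζ) :
    LipschitzEuclid (cubeAvg h ζ) := fun x y => by
  have := abs_cubeAvg_le hh (hζ.abs_fwdDiff_le (x - y)) y
  rw [← fwdDiff_cubeAvg hζ.continuous] at this
  simpa [fwdDiff] using this

lemma LipschitzEuclid.abs_cubeAvg_cubeAvg_sub_le (hζ : LipschitzEuclid ζ) (hD : 0 < D)
    {t : ℝ} (ht : 0 < t) (x : Fin D → ℝ) :
    |_root_.cubeAvg t (_root_.cubeAvg t ζ) x - ζ x| ≤ 5 / 6 * (t * √D) := by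
  have hD' : (0 : ℝ) < D := Nat.cast_pos.2 hD
  have hsD : 0 < √(D : ℝ) := Real.sqrt_pos.2 hD'
  set c : ℝ := t * √D with hc
  have hcpos : 0 < c := by positivity
  have hw : ∀ z, |ζ z - ζ x| ≤ (2 * c)⁻¹ * ∑ i, (z i - x i) ^ 2 + c / 2 := fun z =>
    (hζ z x).trans (sqrt_le_mul_add_div_two (by positivity) hcpos)
  have hwc : ∀ A B : ℝ, Continuous fun z : Fin D → ℝ => A * ∑ i, (z i - x i) ^ 2 + B :=
    fun A B => by fun_prop
  have h1 := abs_cubeAvg_sub_le ht hζ.continuous (hwc _ _) hw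
  rw [cubeAvg_quadratic ht] at h1
  have h2 := abs_cubeAvg_sub_le ht (continuous_cubeAvg hζ.continuous t) (hwc _ _) h1 x
  rw [cubeAvg_quadratic ht] at h2
  refine h2.trans_eq ?_
  have hDt : D * t ^ 2 = c ^ 2 := by rw [hc, mul_pow, Real.sq_sqrt hD'.le]; ring
  have h3 : (2 * c)⁻¹ * (D * (t ^ 2 / 3)) = c / 6 := by
    rw [← mul_div_assoc, hDt]
    field_simp
    norm_num
  simp only [h3, sub_self]
  simp
  ring

/-- A `1`-Lipschitz function is within `t * √D` of a `C³` function whose partial derivatives of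
order one, two and three are at most `1`, `1 / t` and `1 / t ^ 2`. -/
lemma LipschitzEuclid.exists_testD3_near (hζ : LipschitzEuclid ζ) (hD : 0 < D) {t : ℝ}
    (ht : 0 < t) (ht1 : t ≤ 1) : ∃ g : (Fin D → ℝ) → ℝ, Continuous g ∧
      TestD3 (t ^ 2 • g) ∧ ∀ x, |g x - ζ x| ≤ t * √D := by
  let φ : ContDiffBump (0 : Fin D → ℝ) := ⟨t / 12, t / 6, by positivity, by linarith⟩
  have hcT : ∀ {f : (Fin D → ℝ) → ℝ}, Continuous f → Continuous (_root_.cubeAvg t f) :=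
    fun hf => continuous_cubeAvg hf t
  have hcd : ∀ {f : (Fin D → ℝ) → ℝ} (v), Continuous f → Continuous (fwdDiff v f) :=
    fun v hf => by unfold fwdDiff; fun_prop
  have hζc := hζ.continuous
  have hL := (hζ.cubeAvg ht).cubeAvg ht
  refine ⟨mollify φ (_root_.cubeAvg t (_root_.cubeAvg t ζ)),
    (contDiff_mollify φ hL.continuous).continuous, ?_, fun x => ?_⟩
  · have hs : |t ^ 2| = t ^ 2 := abs_of_nonneg (by positivity)
    have hb1 : ∀ i, ∀ a : ℝ, 0 < a → ∀ x, |fwdDiff (a • Pi.single i 1) ζ x| ≤ a :=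
      fun i a ha => hζ.abs_fwdDiff_single_le i ha.le
    have hb2 : ∀ i j, ∀ a b : ℝ, 0 < a → 0 < b → ∀ x, |fwdDiff (b • Pi.single j 1)
        (_root_.cubeAvg t (fwdDiff (a • Pi.single i 1) ζ)) x| ≤ a * b / t :=
      fun i j a b ha hb => abs_fwdDiff_cubeAvg_le ht (hcd _ hζc) (hb1 i a ha) j hb.le
    refine TestD3.of_abs_fwdDiff_le (contDiff_const.smul (contDiff_mollify φ hL.continuous)) ?_ ?_ ?_
    · intro i a ha x
      rw [fwdDiff_const_smul, fwdDiff_mollify φ hL.continuous, fwdDiff_cubeAvg (hcT hζc),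
        fwdDiff_cubeAvg hζc, Pi.smul_apply, smul_eq_mul, abs_mul, hs]
      refine (mul_le_mul_of_nonneg_left (abs_mollify_le φ (hcT (hcT (hcd _ hζc)))
        (abs_cubeAvg_le ht (abs_cubeAvg_le ht (hb1 i a ha))) x) (by positivity)).trans ?_
      exact mul_le_of_le_one_left ha.le (pow_le_one₀ ht.le ht1)
    · intro i j a b ha hb x
      have hc1 := hcd (a • Pi.single i 1) hζc
      rw [fwdDiff_const_smul, fwdDiff_const_smul, fwdDiff_mollify φ hL.continuous,
        fwdDiff_cubeAvg (hcT hζc), fwdDiff_cubeAvg hζc, fwdDiff_mollify φ (hcT (hcT hc1)),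
        fwdDiff_cubeAvg (hcT hc1), Pi.smul_apply, smul_eq_mul, abs_mul, hs]
      refine (mul_le_mul_of_nonneg_left (abs_mollify_le φ (hcT (hcd _ (hcT hc1)))
        (abs_cubeAvg_le ht (hb2 i j a b ha hb)) x) (by positivity)).trans ?_
      have : t ^ 2 * (a * b / t) = t * (a * b) := by field_simp
      rw [this]
      exact mul_le_of_le_one_left (by positivity) ht1
    · intro i j k a b c ha hb hc x
      have hc1 := hcd (a • Pi.single i 1) hζc
      have hc2 := hcd (b • Pi.single j 1) (hcT hc1)
      rw [fwdDiff_const_smul, fwdDiff_const_smul, fwdDiff_const_smul,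
        fwdDiff_mollify φ hL.continuous,
        fwdDiff_cubeAvg (hcT hζc), fwdDiff_cubeAvg hζc, fwdDiff_mollify φ (hcT (hcT hc1)),
        fwdDiff_cubeAvg (hcT hc1), fwdDiff_mollify φ (hcT hc2),
        Pi.smul_apply, smul_eq_mul, abs_mul, hs]
      refine (mul_le_mul_of_nonneg_left (abs_mollify_le φ (hcd _ (hcT hc2))
        (abs_fwdDiff_cubeAvg_le ht hc2 (hb2 i j a b ha hb) k hc.le) x)
        (by positivity)).trans_eq ?_
      field_simp
  · have h1 := hζ.abs_cubeAvg_cubeAvg_sub_le hD ht x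
    have h2 := φ.dist_normed_convolution_le (μ := volume) (x₀ := x) (ε := √D * (t / 6))
      hL.continuous.aestronglyMeasurable fun z hz => by
        rw [Real.dist_eq]
        refine (hL z x).trans ((sqrt_sum_sq_le_sqrt_card_mul_norm (z - x)).trans ?_)
        gcongr
        exact (mem_ball_iff_norm.1 hz).le
    rw [Real.dist_eq] at h2
    refine (abs_sub_le _ (_root_.cubeAvg t (_root_.cubeAvg t ζ) x) _).trans
      ((add_le_add h2 h1).trans_eq ?_)
    ring

end LipschitzEuclid

section distances

variable {Ω : Type*} [MeasurableSpace Ω] {μ : Measure Ω} {D : ℕ} {U V : Ω → Fin D → ℝ}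

lemma d3_nonneg : 0 ≤ d3 μ U V :=
  Real.sSup_nonneg (by rintro _ ⟨ζ, -, rfl⟩; exact abs_nonneg _)

lemma norm_le_sqrt_sum_sq {ι : Type*} [Fintype ι] (v : ι → ℝ) : ‖v‖ ≤ √(∑ i, v i ^ 2) :=
  (pi_norm_le_iff_of_nonneg (Real.sqrt_nonneg _)).2 fun i => Real.abs_le_sqrt
    (Finset.single_le_sum (f := fun i => v i ^ 2) (fun _ _ => sq_nonneg _) (Finset.mem_univ i))

lemma TestD3.lipschitzEuclid {ζ : (Fin D → ℝ) → ℝ} (hζ : TestD3 ζ) (hD : 0 < D) :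
    LipschitzEuclid fun x => (D : ℝ)⁻¹ * ζ x := by
  have hD' : (0 : ℝ) < D := Nat.cast_pos.2 hD
  have hn : ∀ x, ‖fderiv ℝ ζ x‖ ≤ D := fun x => by
    refine ContinuousLinearMap.opNorm_le_bound _ hD'.le fun v => ?_
    calc ‖fderiv ℝ ζ x v‖ = ‖∑ i, fderiv ℝ ζ x (Pi.single i (v i))‖ := by
          rw [← map_sum, Finset.univ_sum_single]
      _ ≤ ∑ i, ‖fderiv ℝ ζ x (Pi.single i (v i))‖ := norm_sum_le _ _
      _ ≤ ∑ _ : Fin D, ‖v‖ := Finset.sum_le_sum fun i _ => by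
          have : (Pi.single i (v i) : Fin D → ℝ) = v i • Pi.single i 1 := by
            rw [← Pi.single_smul, smul_eq_mul, mul_one]
          rw [this, map_smul, smul_eq_mul, norm_mul, ← pd1_eq_fderiv]
          exact (mul_le_of_le_one_right (norm_nonneg _) (hζ.2.1 x i)).trans
            (norm_le_pi_norm v i)
      _ = D * ‖v‖ := by simp
  intro x y
  have := convex_univ.norm_image_sub_le_of_norm_fderiv_le (x := y) (y := x)
    (fun z _ => hζ.1.differentiable three_ne_zero z) (fun z _ => hn z)
    (Set.mem_univ _) (Set.mem_univ _)
  rw [← mul_sub, abs_mul, abs_of_pos (inv_pos.2 hD'), inv_mul_le_iff₀ hD']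
  exact this.trans (mul_le_mul_of_nonneg_left (norm_le_sqrt_sum_sq (x - y)) hD'.le)

lemma le_d3_of_testD3 (hD : 0 < D)
    (hb : BddAbove {r | ∃ ζ : (Fin D → ℝ) → ℝ, LipschitzEuclid ζ ∧
      r = |(∫ ω, ζ (U ω) ∂μ) - ∫ ω, ζ (V ω) ∂μ|})
    {ζ : (Fin D → ℝ) → ℝ} (hζ : TestD3 ζ) :
    |(∫ ω, ζ (U ω) ∂μ) - ∫ ω, ζ (V ω) ∂μ| ≤ d3 μ U V := by
  obtain ⟨B, hB⟩ := hb
  refine le_csSup ⟨D * B, ?_⟩ ⟨ζ, hζ, rfl⟩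
  rintro _ ⟨η, hη, rfl⟩
  have hD' : (0 : ℝ) < D := Nat.cast_pos.2 hD
  have := hB ⟨_, hη.lipschitzEuclid hD, rfl⟩
  rwa [integral_const_mul, integral_const_mul, ← mul_sub, abs_mul, abs_of_pos (inv_pos.2 hD'),
    inv_mul_le_iff₀ hD'] at this

lemma integrable_iff_of_bddAbove [IsProbabilityMeasure μ]
    (hb : BddAbove {r | ∃ ζ : (Fin D → ℝ) → ℝ, LipschitzEuclid ζ ∧
      r = |(∫ ω, ζ (U ω) ∂μ) - ∫ ω, ζ (V ω) ∂μ|})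
    {ζ : (Fin D → ℝ) → ℝ} (hζ : LipschitzEuclid ζ) :
    Integrable (fun ω => ζ (U ω)) μ ↔ Integrable (fun ω => ζ (V ω)) μ := by
  obtain ⟨B, hB⟩ := hb
  have aux : ∀ {X Y : Ω → Fin D → ℝ}, Integrable (fun ω => ζ (X ω)) μ →
      (∀ c, |(∫ ω, (ζ (X ω) + c) ∂μ) - ∫ ω, (ζ (Y ω) + c) ∂μ| ≤ B) →
      Integrable (fun ω => ζ (Y ω)) μ := by
    intro X Y hX hXY
    by_contra hY
    have := hXY (B + 1 - ∫ ω, ζ (X ω) ∂μ)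
    rw [integral_undef (f := fun ω => ζ (Y ω) + _) (by
      rwa [integrable_add_iff_integrable_left' (integrable_const _)]),
      integral_add hX (integrable_const _)] at this
    simp only [integral_const, probReal_univ, one_smul] at this
    have := (le_abs_self _).trans this
    linarith
  refine ⟨fun h => aux h fun c => hB ⟨_, hζ.add_const c, rfl⟩, fun h => aux h fun c => ?_⟩
  rw [abs_sub_comm]
  exact hB ⟨_, hζ.add_const c, rfl⟩

lemma abs_integral_sub_integral_le [IsProbabilityMeasure μ] {f g : (Fin D → ℝ) → ℝ}
    (hg : Continuous g) (hU : Measurable U) (hf : Integrable (fun ω => f (U ω)) μ) {ε : ℝ}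
    (hε : ∀ x, |g x - f x| ≤ ε) : |(∫ ω, g (U ω) ∂μ) - ∫ ω, f (U ω) ∂μ| ≤ ε := by
  have hm : AEStronglyMeasurable (fun ω => g (U ω)) μ :=
    (hg.measurable.comp hU).aestronglyMeasurable
  have hd : Integrable (fun ω => g (U ω) - f (U ω)) μ :=
    .of_bound (hm.sub hf.1) ε (.of_forall fun ω => hε _)
  have hgi : Integrable (fun ω => g (U ω)) μ :=
    (hd.add hf).congr (.of_forall fun ω => sub_add_cancel _ _)
  rw [← integral_sub hgi hf]
  simpa using norm_integral_le_of_norm_le_const (μ := μ)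
    (f := fun ω => g (U ω) - f (U ω)) (.of_forall fun ω => hε (U ω))

lemma abs_integral_sub_integral_le_smoothing [IsProbabilityMeasure μ] (hD : 0 < D)
    (hU : Measurable U) (hV : Measurable V)
    (hb : BddAbove {r | ∃ ζ : (Fin D → ℝ) → ℝ, LipschitzEuclid ζ ∧
      r = |(∫ ω, ζ (U ω) ∂μ) - ∫ ω, ζ (V ω) ∂μ|})
    {ζ : (Fin D → ℝ) → ℝ} (hζ : LipschitzEuclid ζ) {t : ℝ} (ht : 0 < t) (ht1 : t ≤ 1) :
    |(∫ ω, ζ (U ω) ∂μ) - ∫ ω, ζ (V ω) ∂μ| ≤ 2 * √D * t + d3 μ U V / t ^ 2 := by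
  have h0 : 0 ≤ d3 μ U V := d3_nonneg
  by_cases hi : Integrable (fun ω => ζ (U ω)) μ
  · have hi' := (integrable_iff_of_bddAbove hb hζ).1 hi
    obtain ⟨g, hgc, hgt, hgζ⟩ := hζ.exists_testD3_near hD ht ht1
    have h1 := abs_integral_sub_integral_le hgc hU hi hgζ
    have h2 := abs_integral_sub_integral_le hgc hV hi' hgζ
    have h3 := le_d3_of_testD3 hD hb hgt
    simp only [Pi.smul_apply, smul_eq_mul] at h3
    rw [integral_const_mul, integral_const_mul, ← mul_sub, abs_mul,
      abs_of_pos (by positivity : 0 < t ^ 2), mul_comm, ← le_div_iff₀ (by positivity)] at h3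
    rw [abs_le] at h1 h2 h3 ⊢
    constructor <;> linarith [h1.1, h1.2, h2.1, h2.2, h3.1, h3.2]
  · rw [integral_undef hi, integral_undef ((integrable_iff_of_bddAbove hb hζ).not.1 hi)]
    simp only [sub_self, abs_zero]
    positivity

end distances

lemma le_two_mul_rpow_mul_rpow {a d r : ℝ} (ha : 0 < a) (hd : 0 ≤ d) (hda : d ≤ a)
    (h : ∀ t, 0 < t → t ≤ 1 → r ≤ a * t + d / t ^ 2) :
    r ≤ 2 * a ^ ((2 : ℝ) / 3) * d ^ ((1 : ℝ) / 3) := by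
  rcases hd.eq_or_lt with rfl | hd
  · rw [Real.zero_rpow (by norm_num), mul_zero]
    refine le_of_forall_pos_le_add fun ε hε => ?_
    have := h (min 1 (ε / a)) (by positivity) (min_le_left _ _)
    have h2 : a * min 1 (ε / a) ≤ a * (ε / a) := by gcongr; exact min_le_right _ _
    rw [mul_div_cancel₀ _ ha.ne'] at h2
    rw [zero_div] at this
    linarith
  · set p := a ^ ((1 : ℝ) / 3) with hp
    set q := d ^ ((1 : ℝ) / 3) with hq
    have hp0 : 0 < p := by positivity
    have hq0 : 0 < q := by positivity
    have hpa : p ^ 3 = a := by rw [hp, ← Real.rpow_mul_natCast ha.le]; norm_num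
    have hqd : q ^ 3 = d := by rw [hq, ← Real.rpow_mul_natCast hd.le]; norm_num
    have hpp : a ^ ((2 : ℝ) / 3) = p ^ 2 := by
      rw [hp, ← Real.rpow_mul_natCast ha.le]; norm_num
    have hqp : q ≤ p := Real.rpow_le_rpow hd.le hda (by norm_num)
    refine (h (q / p) (by positivity) ((div_le_one hp0).2 hqp)).trans_eq ?_
    rw [hpp, ← hpa, ← hqd]
    field_simp
    ring

/-- **Smoothing lemma.** If `U` and `V` are random vectors in `ℝ^D` with
`d₃(U,V) ≤ 2√D`, then `d₁(U,V) ≤ 2 (2√D)^{2/3} d₃(U,V)^{1/3}`. -/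
theorem stmt13 {Ω : Type*} [MeasurableSpace Ω] (μ : Measure Ω) [IsProbabilityMeasure μ]
    (D : ℕ) (U V : Ω → Fin D → ℝ) (hU : Measurable U) (hV : Measurable V)
    (hUV : d3 μ U V ≤ 2 * Real.sqrt D) :
    d1 μ U V ≤ 2 * (2 * Real.sqrt D) ^ ((2 : ℝ) / 3) * d3 μ U V ^ ((1 : ℝ) / 3) := by
  have h0 : 0 ≤ d3 μ U V := d3_nonneg
  by_cases hb : BddAbove {r | ∃ ζ : (Fin D → ℝ) → ℝ, LipschitzEuclid ζ ∧
      r = |(∫ ω, ζ (U ω) ∂μ) - ∫ ω, ζ (V ω) ∂μ|}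
  · have hr : 0 ≤ 2 * (2 * √(D : ℝ)) ^ ((2 : ℝ) / 3) * d3 μ U V ^ ((1 : ℝ) / 3) := by
      positivity
    refine Real.sSup_le ?_ hr
    rintro _ ⟨ζ, hζ, rfl⟩
    rcases D.eq_zero_or_pos with rfl | hD
    · refine Eq.trans_le ?_ hr
      rw [Subsingleton.elim U V, sub_self, abs_zero]
    · exact le_two_mul_rpow_mul_rpow (by positivity) h0 hUV fun t ht ht1 =>
        abs_integral_sub_integral_le_smoothing hD hU hV hb hζ ht ht1
  · rw [d1, Real.sSup_of_not_bddAbove hb]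
    positivity

end
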